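/- The determinant of M equals -4, and the cokernel ℤ¹⁸ / M·ℤ¹⁸ of the linear map ℤ¹⁸ → ℤ¹⁸ given by M is isomorphic as an abelian group to (ℤ/2ℤ) × (ℤ/2ℤ). Moreover there exist a matrix P ∈ GL(18, ℤ) and a 16×16 symmetric integer matrix K₂ such that Pᵀ M P equals the block-diagonal matrix U ⊕ K₂, where K₂ is negative definite with even diagonal entries and det K₂ = 4. -/

import Mathlib

open Matrix

def M : Matrix (Fin 18) (Fin 18) ℤ :=
  !![0, 0, 0, 0, 1, 1, 1, 0, 0, 0, 0, 0, 0, 0, 0, 0, 0, 0;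
    0, -2, 0, 0, 0, 0, 1, 1, 0, 0, 0, 0, 0, 1, 0, 0, 0, 0;
    0, 0, -2, 0, 1, 0, 0, 0, 0, 0, 1, 0, 0, 0, 0, 0, 0, 1;
    0, 0, 0, -2, 0, 1, 0, 0, 0, 1, 0, 0, 0, 0, 0, 0, 0, 0;
    1, 0, 1, 0, -2, 0, 0, 0, 0, 0, 0, 0, 0, 0, 0, 0, 0, 0;
    1, 0, 0, 1, 0, -2, 0, 0, 0, 0, 0, 0, 0, 0, 0, 0, 0, 0;
    1, 1, 0, 0, 0, 0, -2, 0, 0, 0, 0, 0, 0, 0, 0, 0, 0, 0;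
    0, 1, 0, 0, 0, 0, 0, -2, 1, 0, 0, 0, 0, 0, 0, 0, 0, 0;
    0, 0, 0, 0, 0, 0, 0, 1, -2, 1, 0, 0, 0, 0, 0, 0, 0, 0;
    0, 0, 0, 1, 0, 0, 0, 0, 1, -2, 0, 0, 0, 0, 0, 0, 0, 0;
    0, 0, 1, 0, 0, 0, 0, 0, 0, 0, -2, 1, 0, 0, 0, 0, 0, 0;
    0, 0, 0, 0, 0, 0, 0, 0, 0, 0, 1, -2, 1, 0, 0, 0, 0, 0;
    0, 0, 0, 0, 0, 0, 0, 0, 0, 0, 0, 1, -2, 0, 0, 0, 0, 0;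
    0, 1, 0, 0, 0, 0, 0, 0, 0, 0, 0, 0, 0, -2, 1, 0, 0, 0;
    0, 0, 0, 0, 0, 0, 0, 0, 0, 0, 0, 0, 0, 1, -2, 1, 0, 0;
    0, 0, 0, 0, 0, 0, 0, 0, 0, 0, 0, 0, 0, 0, 1, -2, 1, 0;
    0, 0, 0, 0, 0, 0, 0, 0, 0, 0, 0, 0, 0, 0, 0, 1, -2, 1;
    0, 0, 1, 0, 0, 0, 0, 0, 0, 0, 0, 0, 0, 0, 0, 0, 1, -2]

def U2 : Matrix (Fin 2) (Fin 2) ℤ :=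
  !![0, 1;
    1, 0]

section CokernelCertificate

variable {n m : Type*} [Fintype n] [DecidableEq n] [Fintype m] [DecidableEq m]

/-- An integer matrix `Φ` induces an isomorphism from the cokernel of `A` onto `(ℤ/p)ᵐ` as soon as
it admits a section `E` and auxiliary matrices `F`, `C`, `R` satisfying the listed identities. -/
theorem nonempty_coker_addEquiv_zmod (p : ℕ) {A R : Matrix n n ℤ} {Φ F : Matrix m n ℤ}
    {E C : Matrix n m ℤ} (hΦE : Φ * E = 1) (hΦA : Φ * A = (p : ℤ) • F)
    (hAC : A * C = (p : ℤ) • E) (hR : E * Φ + A * R = 1) :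
    Nonempty (((n → ℤ) ⧸ LinearMap.range (Matrix.toLin' A)) ≃+ (m → ZMod p)) := by
  let red : (m → ℤ) →ₗ[ℤ] (m → ZMod p) :=
    ((Int.castAddHom (ZMod p)).toIntLinearMap).compLeft m
  let f : (n → ℤ) →ₗ[ℤ] (m → ZMod p) := red ∘ₗ Matrix.toLin' Φ
  have hf (v : n → ℤ) (i : m) : f v i = (((Φ *ᵥ v) i : ℤ) : ZMod p) := rfl
  have hsurj : Function.Surjective f := by
    intro y
    choose x hx using fun i => ZMod.intCast_surjective (y i)
    refine ⟨E *ᵥ x, funext fun i => ?_⟩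
    rw [hf, Matrix.mulVec_mulVec, hΦE, Matrix.one_mulVec, hx]
  have hker : LinearMap.ker f = LinearMap.range (Matrix.toLin' A) := by
    ext v
    rw [LinearMap.mem_ker, LinearMap.mem_range]
    constructor
    · intro hv
      have hdvd (i : m) : (p : ℤ) ∣ (Φ *ᵥ v) i := by
        rw [← ZMod.intCast_zmod_eq_zero_iff_dvd, ← hf, hv, Pi.zero_apply]
      choose u hu using hdvd
      have hu' : Φ *ᵥ v = (p : ℤ) • u := funext hu
      refine ⟨C *ᵥ u + R *ᵥ v, ?_⟩
      rw [Matrix.toLin'_apply, Matrix.mulVec_add, Matrix.mulVec_mulVec, Matrix.mulVec_mulVec, hAC,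
        Matrix.smul_mulVec, ← Matrix.mulVec_smul, ← hu', Matrix.mulVec_mulVec,
        ← Matrix.add_mulVec, hR, Matrix.one_mulVec]
    · rintro ⟨w, rfl⟩
      ext i
      rw [hf, Matrix.toLin'_apply, Matrix.mulVec_mulVec, hΦA, Matrix.smul_mulVec]
      simp
  rw [← hker]
  exact ⟨(f.quotKerEquivOfSurjective hsurj).toAddEquiv⟩

end CokernelCertificate

section SumOfSquares

variable {n : Type*} [Fintype n] [DecidableEq n] {c : ℤ} {w : n → ℤ} {A B : Matrix n n ℤ}

theorem dotProduct_mulVec_neg_of_smul_eq_neg_sum_sq (hc : 0 < c) (hw : ∀ i, 0 < w i)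
    (hB : B.det ≠ 0) (h : c • A = -(Bᵀ * diagonal w * B)) {v : n → ℤ} (hv : v ≠ 0) :
    v ⬝ᵥ (A *ᵥ v) < 0 := by
  have hBv : B *ᵥ v ≠ 0 := fun h0 => hv (Matrix.eq_zero_of_mulVec_eq_zero hB h0)
  obtain ⟨i, hi⟩ := Function.ne_iff.mp hBv
  have hpos : 0 < ∑ j, w j * (B *ᵥ v) j ^ 2 :=
    Finset.sum_pos' (fun j _ => mul_nonneg (hw j).le (sq_nonneg _))
      ⟨i, Finset.mem_univ i, mul_pos (hw i) (sq_pos_of_ne_zero hi)⟩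
  have key : c * (v ⬝ᵥ (A *ᵥ v)) = -∑ j, w j * (B *ᵥ v) j ^ 2 := by
    rw [← smul_eq_mul, ← dotProduct_smul, ← Matrix.smul_mulVec, h, Matrix.neg_mulVec,
      dotProduct_neg, ← Matrix.mulVec_mulVec, ← Matrix.mulVec_mulVec, Matrix.dotProduct_mulVec,
      Matrix.vecMul_transpose]
    simp only [dotProduct, Matrix.mulVec_diagonal]
    exact congrArg _ (Finset.sum_congr rfl fun j _ => by ring)
  nlinarith

theorem pow_card_mul_det_of_smul_eq_neg_sum_sq (h : c • A = -(Bᵀ * diagonal w * B)) :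
    c ^ Fintype.card n * A.det = (-1) ^ Fintype.card n * ((∏ i, w i) * B.det ^ 2) := by
  rw [← Matrix.det_smul, h, Matrix.det_neg, Matrix.det_mul, Matrix.det_mul, Matrix.det_transpose,
    Matrix.det_diagonal]
  ring

end SumOfSquares

/-- A basis of `ℤ¹⁸` whose first two vectors span a hyperbolic plane for `M` and whose other
vectors are orthogonal to that plane. -/
def hyperbolicBasis : Matrix (Fin 18) (Fin 18) ℤ :=
  !![1, 1, 0, 0, 0, 0, 0, 0, 0, 0, 0, 0, 0, 0, 0, -1, -2, -2;
    0, 0, 0, 0, 0, 0, 0, 0, 0, 0, 0, 0, 0, 0, 1, 0, 0, 0;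
    0, 0, 0, 0, 0, 0, 0, 0, 0, 0, 0, 0, 0, 0, 0, 1, 0, 0;
    0, 0, 0, 0, 0, 0, 0, 0, 0, 0, 0, 0, 0, 1, 0, 0, 0, 0;
    0, 1, 0, 0, 0, 0, 0, 0, 0, 0, 0, 0, 0, 0, 0, 0, -1, -1;
    0, 0, 0, 0, 0, 0, 0, 0, 0, 0, 0, 0, 0, 0, 0, 0, 1, 0;
    0, 0, 0, 0, 0, 0, 0, 0, 0, 0, 0, 0, 0, 0, 0, 0, 0, 1;
    0, 0, 0, 0, 0, 0, 0, 1, 0, 0, 0, 0, 0, 0, 0, 0, 0, 0;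
    0, 0, 0, 0, 0, 0, 1, 0, 0, 0, 0, 0, 0, 0, 0, 0, 0, 0;
    0, 0, 0, 0, 0, 1, 0, 0, 0, 0, 0, 0, 0, 0, 0, 0, 0, 0;
    0, 0, 0, 0, 1, 0, 0, 0, 0, 0, 0, 0, 0, 0, 0, 0, 0, 0;
    0, 0, 0, 1, 0, 0, 0, 0, 0, 0, 0, 0, 0, 0, 0, 0, 0, 0;
    0, 0, 1, 0, 0, 0, 0, 0, 0, 0, 0, 0, 0, 0, 0, 0, 0, 0;
    0, 0, 0, 0, 0, 0, 0, 0, 1, 0, 0, 0, 0, 0, 0, 0, 0, 0;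
    0, 0, 0, 0, 0, 0, 0, 0, 0, 1, 0, 0, 0, 0, 0, 0, 0, 0;
    0, 0, 0, 0, 0, 0, 0, 0, 0, 0, 1, 0, 0, 0, 0, 0, 0, 0;
    0, 0, 0, 0, 0, 0, 0, 0, 0, 0, 0, 1, 0, 0, 0, 0, 0, 0;
    0, 0, 0, 0, 0, 0, 0, 0, 0, 0, 0, 0, 1, 0, 0, 0, 0, 0]

def hyperbolicBasisInv : Matrix (Fin 18) (Fin 18) ℤ :=
  !![1, 0, 1, 0, -1, 1, 1, 0, 0, 0, 0, 0, 0, 0, 0, 0, 0, 0;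
    0, 0, 0, 0, 1, 1, 1, 0, 0, 0, 0, 0, 0, 0, 0, 0, 0, 0;
    0, 0, 0, 0, 0, 0, 0, 0, 0, 0, 0, 0, 1, 0, 0, 0, 0, 0;
    0, 0, 0, 0, 0, 0, 0, 0, 0, 0, 0, 1, 0, 0, 0, 0, 0, 0;
    0, 0, 0, 0, 0, 0, 0, 0, 0, 0, 1, 0, 0, 0, 0, 0, 0, 0;
    0, 0, 0, 0, 0, 0, 0, 0, 0, 1, 0, 0, 0, 0, 0, 0, 0, 0;
    0, 0, 0, 0, 0, 0, 0, 0, 1, 0, 0, 0, 0, 0, 0, 0, 0, 0;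
    0, 0, 0, 0, 0, 0, 0, 1, 0, 0, 0, 0, 0, 0, 0, 0, 0, 0;
    0, 0, 0, 0, 0, 0, 0, 0, 0, 0, 0, 0, 0, 1, 0, 0, 0, 0;
    0, 0, 0, 0, 0, 0, 0, 0, 0, 0, 0, 0, 0, 0, 1, 0, 0, 0;
    0, 0, 0, 0, 0, 0, 0, 0, 0, 0, 0, 0, 0, 0, 0, 1, 0, 0;
    0, 0, 0, 0, 0, 0, 0, 0, 0, 0, 0, 0, 0, 0, 0, 0, 1, 0;
    0, 0, 0, 0, 0, 0, 0, 0, 0, 0, 0, 0, 0, 0, 0, 0, 0, 1;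
    0, 0, 0, 1, 0, 0, 0, 0, 0, 0, 0, 0, 0, 0, 0, 0, 0, 0;
    0, 1, 0, 0, 0, 0, 0, 0, 0, 0, 0, 0, 0, 0, 0, 0, 0, 0;
    0, 0, 1, 0, 0, 0, 0, 0, 0, 0, 0, 0, 0, 0, 0, 0, 0, 0;
    0, 0, 0, 0, 0, 1, 0, 0, 0, 0, 0, 0, 0, 0, 0, 0, 0, 0;
    0, 0, 0, 0, 0, 0, 1, 0, 0, 0, 0, 0, 0, 0, 0, 0, 0, 0]

/-- The Gram matrix of the orthogonal complement of the hyperbolic plane. -/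
def complementGram : Matrix (Fin 16) (Fin 16) ℤ :=
  (hyperbolicBasisᵀ * M * hyperbolicBasis).submatrix (Fin.natAdd 2) (Fin.natAdd 2)

def squareForms : Matrix (Fin 16) (Fin 16) ℤ :=
  !![2, -1, 0, 0, 0, 0, 0, 0, 0, 0, 0, 0, 0, 0, 0, 0;
    0, 3, -2, 0, 0, 0, 0, 0, 0, 0, 0, 0, 0, 0, 0, 0;
    0, 0, 4, 0, 0, 0, 0, 0, 0, 0, 0, 0, 0, -3, 0, 0;
    0, 0, 0, 2, -1, 0, 0, 0, 0, 0, 0, -1, 0, 0, 0, 0;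
    0, 0, 0, 0, 3, -2, 0, 0, 0, 0, 0, -1, 0, 0, 0, 0;
    0, 0, 0, 0, 0, 4, 0, 0, 0, 0, 0, -1, -3, 0, 0, 0;
    0, 0, 0, 0, 0, 0, 2, -1, 0, 0, 0, 0, -1, 0, 0, 0;
    0, 0, 0, 0, 0, 0, 0, 3, -2, 0, 0, 0, -1, 0, 0, 0;
    0, 0, 0, 0, 0, 0, 0, 0, 4, -3, 0, 0, -1, 0, 0, 0;
    0, 0, 0, 0, 0, 0, 0, 0, 0, 5, -4, 0, -1, 0, 0, 0;
    0, 0, 0, 0, 0, 0, 0, 0, 0, 0, 6, 0, -1, -5, 0, 0;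
    0, 0, 0, 0, 0, 0, 0, 0, 0, 0, 0, 5, -1, 0, -4, 0;
    0, 0, 0, 0, 0, 0, 0, 0, 0, 0, 0, 0, 11, -5, -6, -30;
    0, 0, 0, 0, 0, 0, 0, 0, 0, 0, 0, 0, 0, 15, 40, 24;
    0, 0, 0, 0, 0, 0, 0, 0, 0, 0, 0, 0, 0, 0, 1, 0;
    0, 0, 0, 0, 0, 0, 0, 0, 0, 0, 0, 0, 0, 0, 0, 1]

def squareWeights : Fin 16 → ℤ :=
  ![330, 110, 55, 330, 110, 55, 330, 110, 55, 33, 22, 33, 2, 1, 440, 264]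

/-- The rows generate, modulo `2`, the characters of `ℤ¹⁸` that vanish on the image of `M`. -/
def cokerCharacters : Matrix (Fin 2) (Fin 18) ℤ :=
  !![0, 0, 0, 0, 0, 1, 1, 1, 0, 1, 0, 0, 0, 0, 0, 0, 0, 0;
    0, 0, 0, 0, 1, 0, 1, 0, 0, 0, 0, 0, 0, 1, 0, 1, 0, 1]

/-- Representatives of generators of the cokernel of `M`. -/
def cokerGenerators : Matrix (Fin 18) (Fin 2) ℤ :=
  fun i j => if i = ![5, 4] j then 1 else 0

def cokerRelations : Matrix (Fin 18) (Fin 2) ℤ :=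
  !![-2, 2;
    2, 8;
    8, -16;
    -2, 4;
    3, -8;
    -3, 3;
    0, 5;
    1, 7;
    0, 6;
    -1, 5;
    6, -12;
    4, -8;
    2, -4;
    3, 4;
    4, 0;
    5, -4;
    6, -8;
    7, -12]

def cokerRetraction : Matrix (Fin 18) (Fin 18) ℤ :=
  !![-2, 4, 4, 0, 0, 0, 1, 4, 2, 2, 3, 2, 1, 3, 4, 3, 4, 3;
    4, -14, 4, -2, 0, 0, -10, -12, -8, -6, 3, 2, 1, -15, -8, -9, -2, -3;
    4, 4, -20, 4, 0, 0, 8, 0, 4, 0, -15, -10, -5, 8, -4, 0, -12, -8;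
    0, -2, 4, -2, 0, 0, -2, -1, -2, -1, 3, 2, 1, -3, 0, -1, 2, 1;
    1, 4, -8, 2, 0, 0, 5, 2, 3, 1, -6, -4, -2, 6, 0, 2, -4, -2;
    -1, 1, 4, -1, 0, 0, 0, 2, 0, 1, 3, 2, 1, 0, 2, 1, 3, 2;
    1, -5, 4, -1, 0, 0, -5, -4, -3, -2, 3, 2, 1, -6, -2, -3, 1, 0;
    3, -11, 4, -2, 0, 0, -8, -10, -7, -5, 3, 2, 1, -12, -6, -7, -1, -2;
    2, -8, 4, -2, 0, 0, -6, -7, -6, -4, 3, 2, 1, -9, -4, -5, 0, -1;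
    1, -5, 4, -2, 0, 0, -4, -4, -4, -3, 3, 2, 1, -6, -2, -3, 1, 0;
    3, 3, -15, 3, 0, 0, 6, 0, 3, 0, -12, -8, -4, 6, -3, 0, -9, -6;
    2, 2, -10, 2, 0, 0, 4, 0, 2, 0, -8, -6, -3, 4, -2, 0, -6, -4;
    1, 1, -5, 1, 0, 0, 2, 0, 1, 0, -4, -3, -2, 2, -1, 0, -3, -2;
    4, -11, 0, -1, 0, 0, -7, -10, -6, -5, 0, 0, 0, -12, -8, -8, -4, -4;
    4, -8, -4, 0, 0, 0, -4, -8, -4, -4, -3, -2, -1, -8, -8, -7, -6, -5;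
    4, -5, -8, 1, 0, 0, -1, -6, -2, -3, -6, -4, -2, -4, -7, -6, -8, -6;
    4, -2, -12, 2, 0, 0, 2, -4, 0, -2, -9, -6, -3, 0, -6, -4, -10, -7;
    4, 1, -16, 3, 0, 0, 5, -2, 2, -1, -12, -8, -4, 4, -5, -2, -11, -8]

theorem hyperbolicBasis_mul_inv : hyperbolicBasis * hyperbolicBasisInv = 1 := by
  decide +kernel

theorem hyperbolicBasis_det : hyperbolicBasis.det = 1 ∨ hyperbolicBasis.det = -1 := by
  have h := congrArg Matrix.det hyperbolicBasis_mul_inv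
  rw [Matrix.det_mul, Matrix.det_one] at h
  exact Int.isUnit_iff.mp (IsUnit.of_mul_eq_one _ h)

theorem transpose_mul_M_mul_hyperbolicBasis : hyperbolicBasisᵀ * M * hyperbolicBasis =
    Matrix.reindex finSumFinEquiv finSumFinEquiv (Matrix.fromBlocks U2 0 0 complementGram) := by
  decide +kernel

theorem smul_complementGram_eq :
    (660 : ℤ) • complementGram = -(squareFormsᵀ * diagonal squareWeights * squareForms) := by
  decide +kernel

theorem squareForms_det : squareForms.det = 2 ^ 10 * 3 ^ 5 * 5 ^ 3 * 11 := by
  have htri : squareForms.IsUpperTriangular := by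
    have h : squareForms = of fun i j => if j < i then 0 else squareForms i j := by
      decide +kernel
    intro i j hij
    rw [h, of_apply]
    exact if_pos hij
  rw [Matrix.det_of_isUpperTriangular htri]
  decide +kernel

theorem complementGram_det : complementGram.det = 4 := by
  have h := pow_card_mul_det_of_smul_eq_neg_sum_sq smul_complementGram_eq
  have hw : ∏ i, squareWeights i = 2 ^ 14 * 3 ^ 6 * 5 ^ 10 * 11 ^ 14 := by decide +kernel
  rw [squareForms_det, hw, Fintype.card_fin] at h
  norm_num at h
  linarith

theorem M_det : M.det = -4 := by
  have h := congrArg Matrix.det transpose_mul_M_mul_hyperbolicBasis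
  have hU : U2.det = -1 := by decide +kernel
  rw [Matrix.det_mul, Matrix.det_mul, Matrix.det_transpose, Matrix.det_reindex_self,
    Matrix.det_fromBlocks_zero₂₁, hU, complementGram_det] at h
  rcases hyperbolicBasis_det with hP | hP <;> rw [hP] at h <;> linarith

theorem M_coker :
    Nonempty (((Fin 18 → ℤ) ⧸ LinearMap.range (Matrix.toLin' M)) ≃+ (ZMod 2 × ZMod 2)) := by
  obtain ⟨e⟩ := nonempty_coker_addEquiv_zmod 2 (A := M) (R := cokerRetraction)
    (Φ := cokerCharacters) (F := (cokerCharacters * M).map (· / 2)) (E := cokerGenerators)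
    (C := cokerRelations) (by decide +kernel) (by decide +kernel) (by decide +kernel)
    (by decide +kernel)
  exact ⟨e.trans (LinearEquiv.finTwoArrow ℤ (ZMod 2)).toAddEquiv⟩

theorem stmt_17 :
    M.det = -4 ∧
    Nonempty (((Fin 18 → ℤ) ⧸ LinearMap.range (Matrix.toLin' M)) ≃+ (ZMod 2 × ZMod 2)) ∧
    ∃ (P : Matrix (Fin 18) (Fin 18) ℤ) (K : Matrix (Fin 16) (Fin 16) ℤ),
      (P.det = 1 ∨ P.det = -1) ∧
      K.IsSymm ∧
      (∀ v : Fin 16 → ℤ, v ≠ 0 → v ⬝ᵥ (K *ᵥ v) < 0) ∧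
      (∀ i, Even (K i i)) ∧
      K.det = 4 ∧
      Pᵀ * M * P = Matrix.reindex finSumFinEquiv finSumFinEquiv (Matrix.fromBlocks U2 0 0 K) := by
  refine ⟨M_det, M_coker, hyperbolicBasis, complementGram, hyperbolicBasis_det, ?_, ?_, ?_,
    complementGram_det, transpose_mul_M_mul_hyperbolicBasis⟩
  · unfold Matrix.IsSymm
    decide +kernel
  · intro v hv
    exact dotProduct_mulVec_neg_of_smul_eq_neg_sum_sq (by norm_num) (by decide +kernel)
      (by rw [squareForms_det]; norm_num) smul_complementGram_eq hv
  · decide +kernel
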